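/- (Absolute memorization of ACIL.) Let γ > 0 and let (Xᵢ, Yᵢ), i = 0, 1, 2, …, be a sequence with Xᵢ a real Nᵢ×d matrix and Yᵢ a real Nᵢ×cᵢ matrix. Define recursively R₀ = (X₀ᵀ X₀ + γ I_d)⁻¹, W₀ = R₀ X₀ᵀ Y₀, and for k ≥ 1: R_k = R_{k−1} − R_{k−1} X_kᵀ (I_{N_k} + X_k R_{k−1} X_kᵀ)⁻¹ X_k R_{k−1} and W_k = [ W_{k−1} − R_k X_kᵀ X_k W_{k−1} , R_k X_kᵀ Y_k ]. Then for every k ≥ 0: R_k = (∑_{i=0}^{k} Xᵢᵀ Xᵢ + γ I_d)⁻¹ and W_k = R_k [X₀ᵀ Y₀ ⋯ X_kᵀ Y_k]; that is, the recursively computed weight at every phase is identical to the joint-learning least-squares solution computed from all data of phases 0 through k. -/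

import Mathlib

open Matrix

namespace Matrix

variable {m n : Type*} [Fintype m] [Fintype n]

theorem posSemidef_transpose_mul_self_real (A : Matrix m n ℝ) : (Aᵀ * A).PosSemidef := by
  simpa using posSemidef_conjTranspose_mul_self A

theorem posDef_sum_transpose_mul_self_add_smul_one {ι : Type*} [DecidableEq n] {N : ι → Type*}
    [∀ i, Fintype (N i)] (X : ∀ i, Matrix (N i) n ℝ) (s : Finset ι) {γ : ℝ} (hγ : 0 < γ) :
    (∑ i ∈ s, (X i)ᵀ * X i + γ • (1 : Matrix n n ℝ)).PosDef :=
  (PosDef.one.smul hγ).posSemidef_add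
    (posSemidef_sum s fun i _ => posSemidef_transpose_mul_self_real (X i))

/-- Rank-`m` update of the inverse of a positive definite matrix. -/
theorem PosDef.inv_add_transpose_mul_self [DecidableEq m] [DecidableEq n] {A : Matrix n n ℝ}
    (hA : A.PosDef) (B : Matrix m n ℝ) :
    (A + Bᵀ * B)⁻¹ = A⁻¹ - A⁻¹ * Bᵀ * (1 + B * A⁻¹ * Bᵀ)⁻¹ * B * A⁻¹ := by
  have h : (1 + B * A⁻¹ * Bᵀ).PosDef := by
    refine PosDef.one.add_posSemidef ?_
    simpa using hA.inv.posSemidef.mul_mul_conjTranspose_same B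
  simpa using add_mul_mul_inv_eq_sub A Bᵀ 1 B hA.isUnit isUnit_one (by simpa using h.isUnit)

/-- Updating a regularized least-squares solution by data `B` with zero labels. -/
theorem PosDef.inv_sub_inv_add_transpose_mul_self_mul [DecidableEq n] {A : Matrix n n ℝ}
    (hA : A.PosDef) (B : Matrix m n ℝ) :
    A⁻¹ - (A + Bᵀ * B)⁻¹ * Bᵀ * B * A⁻¹ = (A + Bᵀ * B)⁻¹ := by
  have hAB : IsUnit (A + Bᵀ * B).det := (isUnit_iff_isUnit_det _).1
    (hA.add_posSemidef (posSemidef_transpose_mul_self_real B)).isUnit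
  have hdet : IsUnit A.det := (isUnit_iff_isUnit_det _).1 hA.isUnit
  calc A⁻¹ - (A + Bᵀ * B)⁻¹ * Bᵀ * B * A⁻¹
      = (A + Bᵀ * B)⁻¹ * (A + Bᵀ * B) * A⁻¹ - (A + Bᵀ * B)⁻¹ * Bᵀ * B * A⁻¹ := by
        rw [nonsing_inv_mul _ hAB, Matrix.one_mul]
    _ = (A + Bᵀ * B)⁻¹ * (A * A⁻¹) := by
        rw [Matrix.mul_add, Matrix.add_mul]
        simp only [Matrix.mul_assoc, add_sub_cancel_right]
    _ = (A + Bᵀ * B)⁻¹ := by rw [mul_nonsing_inv _ hdet, Matrix.mul_one]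

end Matrix

/-- Absolute memorization of ACIL: if `R₀ = (X₀ᵀ X₀ + γ I_d)⁻¹`, `W₀ 0 = R₀ X₀ᵀ Y₀`
(where `W k i` denotes the `i`-th column block of the phase-`k` weight matrix
`W_k = [W k 0 ⋯ W k k]`), and for `k ≥ 1`
`R_k = R_{k−1} − R_{k−1} X_kᵀ (I + X_k R_{k−1} X_kᵀ)⁻¹ X_k R_{k−1}` and
`W_k = [ W_{k−1} − R_k X_kᵀ X_k W_{k−1} , R_k X_kᵀ Y_k ]` (blockwise: the old blocks are
updated by `W k i = W (k−1) i − R_k X_kᵀ X_k W (k−1) i` and the new block is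
`W k k = R_k X_kᵀ Y_k`), then for every `k`:
`R_k = (∑_{i=0}^{k} Xᵢᵀ Xᵢ + γ I_d)⁻¹` and every block of `W_k` agrees with the
corresponding block `R_k Xᵢᵀ Yᵢ` of the joint-learning solution
`R_k [X₀ᵀ Y₀ ⋯ X_kᵀ Y_k]` computed from all data of phases `0` through `k`. -/
theorem acil_absolute_memorization (d : ℕ) (γ : ℝ) (hγ : 0 < γ) (N c : ℕ → ℕ)
    (X : ∀ i, Matrix (Fin (N i)) (Fin d) ℝ)
    (Y : ∀ i, Matrix (Fin (N i)) (Fin (c i)) ℝ)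
    (R : ℕ → Matrix (Fin d) (Fin d) ℝ)
    (W : ∀ k i, Matrix (Fin d) (Fin (c i)) ℝ)
    (hR0 : R 0 = ((X 0)ᵀ * X 0 + γ • (1 : Matrix (Fin d) (Fin d) ℝ))⁻¹)
    (hRrec : ∀ k, R (k + 1) =
      R k - R k * (X (k + 1))ᵀ *
        ((1 : Matrix (Fin (N (k + 1))) (Fin (N (k + 1))) ℝ) +
          X (k + 1) * R k * (X (k + 1))ᵀ)⁻¹ * X (k + 1) * R k)
    (hW0 : W 0 0 = R 0 * (X 0)ᵀ * Y 0)
    (hWold : ∀ k, ∀ i ≤ k,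
      W (k + 1) i = W k i - R (k + 1) * (X (k + 1))ᵀ * X (k + 1) * W k i)
    (hWnew : ∀ k, W (k + 1) (k + 1) = R (k + 1) * (X (k + 1))ᵀ * Y (k + 1)) :
    ∀ k, R k = (∑ i ∈ Finset.range (k + 1), (X i)ᵀ * X i +
        γ • (1 : Matrix (Fin d) (Fin d) ℝ))⁻¹ ∧
      ∀ i ≤ k, W k i = R k * (X i)ᵀ * Y i := by
  intro k
  induction k with
  | zero =>
    refine ⟨by simpa using hR0, fun i hi => ?_⟩
    obtain rfl := Nat.le_zero.1 hi
    exact hW0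
  | succ k ih =>
    obtain ⟨hR, hW⟩ := ih
    have hA := posDef_sum_transpose_mul_self_add_smul_one X (Finset.range (k + 1)) hγ
    have hR' : R (k + 1) = (∑ i ∈ Finset.range (k + 1), (X i)ᵀ * X i +
        γ • (1 : Matrix (Fin d) (Fin d) ℝ) + (X (k + 1))ᵀ * X (k + 1))⁻¹ := by
      rw [hRrec, hR, hA.inv_add_transpose_mul_self]
    refine ⟨by rw [hR', Finset.sum_range_succ _ (k + 1), add_right_comm], fun i hi => ?_⟩
    obtain hi | rfl := Nat.le_succ_iff.1 hi
    · have hRR : R k - R (k + 1) * (X (k + 1))ᵀ * X (k + 1) * R k = R (k + 1) := by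
        rw [hR', hR, hA.inv_sub_inv_add_transpose_mul_self_mul]
      rw [hWold k i hi, hW i hi]
      simpa only [Matrix.sub_mul, Matrix.mul_assoc] using
        congrArg (fun M => M * (X i)ᵀ * Y i) hRR
    · exact hWnew k
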